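/- Let μ be an isotropic log-concave probability measure on ℝ^n with density f. Then for every convex body A ⊂ ℝ^n, μ⁺(∂A) ≤ 2√n (n + ln(sup_{y∈A} f(y) / f(x_A))), where x_A is the center of an inball of A of radius r_A (the intrinsic inradius of A). -/

import Mathlib

open MeasureTheory Metric Filter Set Pointwise

noncomputable section

abbrev Euc (n : ℕ) := EuclideanSpace ℝ (Fin n)

/-- `f` is a log-concave (nonnegative) function on `ℝ^n`. -/
def IsLogConcaveFn {n : ℕ} (f : Euc n → ℝ) : Prop :=
  (∀ x, 0 ≤ f x) ∧
  ∀ x y : Euc n, ∀ τ : ℝ, 0 ≤ τ → τ ≤ 1 →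
    f x ^ τ * f y ^ (1 - τ) ≤ f (τ • x + (1 - τ) • y)

/-- The `μ`-perimeter `μ⁺(∂A) = liminf_{ε→0⁺} μ((A + εB₂ⁿ) \ A) / ε`. -/
def muPerim {n : ℕ} (μ : Measure (Euc n)) (A : Set (Euc n)) : ℝ :=
  liminf (fun ε : ℝ => (μ ((A + closedBall (0 : Euc n) ε) \ A)).toReal / ε)
    (nhdsWithin 0 (Ioi 0))

/-- A convex body: compact convex set with nonempty interior. -/
def IsConvexBody {n : ℕ} (A : Set (Euc n)) : Prop :=
  Convex ℝ A ∧ IsCompact A ∧ (interior A).Nonempty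

/-- The intrinsic inradius of `A`. -/
def inradius {n : ℕ} (A : Set (Euc n)) : ℝ :=
  sSup {r : ℝ | 0 < r ∧ ∃ x ∈ A, closedBall x r ⊆ A}


lemma bm_one_compact {K L C : Set ℝ} (hK : IsCompact K) (hL : IsCompact L) (hKn : K.Nonempty)
    (hLn : L.Nonempty) (hC : ∀ x ∈ K, ∀ y ∈ L, x + y ∈ C) :
    volume K + volume L ≤ volume C := by
  have hk := hK.sSup_mem hKn
  have hl := hL.sInf_mem hLn
  set k := sSup K
  set l := sInf L
  have hk' : ∀ x ∈ K, x ≤ k := fun x hx => le_csSup hK.bddAbove hx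
  have hl' : ∀ y ∈ L, l ≤ y := fun y hy => csInf_le hL.bddBelow hy
  have h1 : volume ((fun x => l + x) '' K) = volume K := by
    rw [image_add_left, measure_preimage_add]
  have h2 : volume ((fun x => k + x) '' L) = volume L := by
    rw [image_add_left, measure_preimage_add]
  have hm2 : MeasurableSet ((fun x => k + x) '' L) :=
    (hL.image (by fun_prop)).measurableSet
  have hd : AEDisjoint volume ((fun x => l + x) '' K) ((fun x => k + x) '' L) := by
    refine measure_mono_null (t := {k + l}) ?_ (by simp)
    rintro z ⟨⟨x, hx, rfl⟩, ⟨y, hy, hxy⟩⟩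
    have := hk' x hx
    have := hl' y hy
    simp only [mem_singleton_iff] at *
    linarith
  rw [← h1, ← h2, ← measure_union₀ hm2.nullMeasurableSet hd]
  refine measure_mono ?_
  rintro z (⟨x, hx, rfl⟩ | ⟨y, hy, rfl⟩)
  · simpa [add_comm] using hC x hx l hl
  · exact hC k hk y hy

lemma bm_one {A B C : Set ℝ} (hA : MeasurableSet A) (hB : MeasurableSet B) (hAn : A.Nonempty)
    (hBn : B.Nonempty) {a b : ℝ} (ha : 0 < a) (hb : 0 < b)
    (hC : ∀ x ∈ A, ∀ y ∈ B, a * x + b * y ∈ C) :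
    ENNReal.ofReal a * volume A + ENNReal.ofReal b * volume B ≤ volume C := by
  obtain ⟨x0, hx0⟩ := hAn
  obtain ⟨y0, hy0⟩ := hBn
  have e1 : ENNReal.ofReal a * volume A = volume (a • A) := by
    rw [Measure.addHaar_smul]; simp [abs_of_pos ha]
  have e2 : ENNReal.ofReal b * volume B = volume (b • B) := by
    rw [Measure.addHaar_smul]; simp [abs_of_pos hb]
  have hA' : MeasurableSet (a • A) := hA.const_smul₀ a
  have hB' : MeasurableSet (b • B) := hB.const_smul₀ b
  rw [e1, e2]
  have key : ∀ K ⊆ a • A, IsCompact K → ∀ L ⊆ b • B, IsCompact L →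
      volume K + volume L ≤ volume C := by
    intro K hK hKc L hL hLc
    have h1 : a • x0 ∈ a • A := smul_mem_smul_set hx0
    have h2 : b • y0 ∈ b • B := smul_mem_smul_set hy0
    refine (add_le_add (measure_mono (subset_insert (a • x0) K))
      (measure_mono (subset_insert (b • y0) L))).trans ?_
    refine bm_one_compact (hKc.insert _) (hLc.insert _) (insert_nonempty _ _)
      (insert_nonempty _ _) ?_
    intro x hx y hy
    obtain ⟨x', hx', rfl⟩ := insert_subset h1 hK hx
    obtain ⟨y', hy', rfl⟩ := insert_subset h2 hL hy
    exact hC x' hx' y' hy'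
  rw [hA'.measure_eq_iSup_isCompact, hB'.measure_eq_iSup_isCompact]
  simp only [iSup_and', iSup_subtype']
  have : Nonempty {K : Set ℝ // K ⊆ a • A ∧ IsCompact K} := ⟨⟨∅, by simp⟩⟩
  have : Nonempty {K : Set ℝ // K ⊆ b • B ∧ IsCompact K} := ⟨⟨∅, by simp⟩⟩
  exact ENNReal.iSup_add_iSup_le fun K L => key K.1 K.2.1 K.2.2 L.1 L.2.1 L.2.2

lemma pl_norm {f g h : ℝ → ℝ} (hf : Measurable f) (hg : Measurable g) (hh : Measurable h)
    (f0 : ∀ x, 0 ≤ f x) (g0 : ∀ x, 0 ≤ g x) (h0 : ∀ x, 0 ≤ h x)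
    (f1 : ∀ x, f x ≤ 1) (g1 : ∀ x, g x ≤ 1)
    (fs : ∀ t < 1, ∃ x, t < f x) (gs : ∀ t < 1, ∃ x, t < g x)
    {a b : ℝ} (ha : 0 < a) (hb : 0 < b)
    (H : ∀ x y, min (f x) (g y) ≤ h (a * x + b * y)) :
    ENNReal.ofReal a * (∫⁻ x, ENNReal.ofReal (f x)) +
      ENNReal.ofReal b * (∫⁻ x, ENNReal.ofReal (g x)) ≤ ∫⁻ x, ENNReal.ofReal (h x) := by
  rw [lintegral_eq_lintegral_meas_lt _ (Eventually.of_forall f0) hf.aemeasurable,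
    lintegral_eq_lintegral_meas_lt _ (Eventually.of_forall g0) hg.aemeasurable,
    lintegral_eq_lintegral_meas_lt _ (Eventually.of_forall h0) hh.aemeasurable]
  have mf : Measurable fun t : ℝ => volume {x | t < f x} :=
    Antitone.measurable fun s t hst => measure_mono fun x hx => lt_of_le_of_lt hst hx
  have mg : Measurable fun t : ℝ => volume {x | t < g x} :=
    Antitone.measurable fun s t hst => measure_mono fun x hx => lt_of_le_of_lt hst hx
  rw [← lintegral_const_mul _ mf, ← lintegral_const_mul _ mg,
    ← lintegral_add_left (mf.const_mul _)]
  refine lintegral_mono fun t => ?_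
  by_cases ht : t < 1
  · refine bm_one (measurableSet_lt measurable_const hf) (measurableSet_lt measurable_const hg)
      (fs t ht) (gs t ht) ha hb ?_
    intro x hx y hy
    exact lt_of_lt_of_le (lt_min hx hy) (H x y)
  · have e1 : {x | t < f x} = ∅ := by
      ext x; simp; linarith [f1 x]
    have e2 : {x | t < g x} = ∅ := by
      ext x; simp; linarith [g1 x]
    simp [e1, e2]

open ENNReal in
lemma ennreal_amgm (x y : ℝ≥0∞) {a b : ℝ} (ha : 0 < a) (hb : 0 < b) (hab : a + b = 1) :
    x ^ a * y ^ b ≤ ENNReal.ofReal a * x + ENNReal.ofReal b * y := by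
  have := ENNReal.young_inequality (x ^ a) (y ^ b) (Real.holderConjugate_one_div ha hb hab)
  rw [← ENNReal.rpow_mul, ← ENNReal.rpow_mul, mul_one_div_cancel ha.ne', mul_one_div_cancel hb.ne',
    ENNReal.rpow_one, ENNReal.rpow_one, one_div, one_div, ENNReal.ofReal_inv_of_pos ha,
    ENNReal.ofReal_inv_of_pos hb, ENNReal.div_eq_inv_mul, ENNReal.div_eq_inv_mul, inv_inv, inv_inv]
    at this
  exact this

open ENNReal in
lemma pl_bdd {F G H : ℝ → ℝ≥0∞} (hF : Measurable F) (hG : Measurable G) (hH : Measurable H)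
    {k : ℝ≥0∞} (hk : k ≠ ∞) (Fk : ∀ x, F x ≤ k) (Gk : ∀ x, G x ≤ k)
    {a b : ℝ} (ha : 0 < a) (hb : 0 < b) (hab : a + b = 1)
    (hyp : ∀ x y, F x ^ a * G y ^ b ≤ H (a * x + b * y)) :
    (∫⁻ x, F x) ^ a * (∫⁻ x, G x) ^ b ≤ ∫⁻ x, H x := by
  set M := ⨆ x, F x with hM
  set N := ⨆ x, G x with hN
  have FM : ∀ x, F x ≤ M := fun x => le_iSup F x
  have GN : ∀ x, G x ≤ N := fun x => le_iSup G x
  by_cases M0 : M = 0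
  · have : ∀ x, F x = 0 := fun x => le_antisymm (M0 ▸ FM x) bot_le
    simp [this, ENNReal.zero_rpow_of_pos ha]
  by_cases N0 : N = 0
  · have : ∀ x, G x = 0 := fun x => le_antisymm (N0 ▸ GN x) bot_le
    simp [this, ENNReal.zero_rpow_of_pos hb]
  have Mt : M ≠ ∞ := ne_top_of_le_ne_top hk (iSup_le Fk)
  have Nt : N ≠ ∞ := ne_top_of_le_ne_top hk (iSup_le Gk)
  set c := M ^ a * N ^ b with hc
  have c0 : c ≠ 0 := mul_ne_zero (by simp [ENNReal.rpow_eq_zero_iff, M0, Mt])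
    (by simp [ENNReal.rpow_eq_zero_iff, N0, Nt])
  have ct : c ≠ ∞ := ENNReal.mul_ne_top (ENNReal.rpow_ne_top_of_nonneg ha.le Mt)
    (ENNReal.rpow_ne_top_of_nonneg hb.le Nt)
  have Fd : ∀ x, F x / M ≤ 1 := fun x => ENNReal.div_le_of_le_mul (by simpa using FM x)
  have Gd : ∀ x, G x / N ≤ 1 := fun x => ENNReal.div_le_of_le_mul (by simpa using GN x)
  have Fdt : ∀ x, F x / M ≠ ∞ := fun x => ne_top_of_le_ne_top one_ne_top (Fd x)
  have Gdt : ∀ x, G x / N ≠ ∞ := fun x => ne_top_of_le_ne_top one_ne_top (Gd x)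
  have Hdt : ∀ x, min (H x / c) 1 ≠ ∞ := fun x => ne_top_of_le_ne_top one_ne_top (min_le_right _ _)
  have aux : ∀ (P : ℝ → ℝ≥0∞) (Q : ℝ≥0∞), Q = (⨆ x, P x) → Q ≠ 0 → Q ≠ ∞ →
      ∀ t < (1 : ℝ), ∃ x, t < (P x / Q).toReal := by
    intro P Q hQ hQ0 hQt t ht
    have h1 : ENNReal.ofReal t * Q < Q := by
      conv_rhs => rw [← one_mul Q]
      exact ENNReal.mul_lt_mul_left hQ0 hQt (by simpa using ht)
    have h1' := h1
    rw [hQ] at h1'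
    obtain ⟨x, hx⟩ := lt_iSup_iff.1 h1'
    rw [← hQ] at hx
    have hPQ : P x ≤ Q := hQ ▸ le_iSup P x
    have hPt : P x / Q ≠ ∞ := ne_top_of_le_ne_top one_ne_top
      (ENNReal.div_le_of_le_mul (by simpa using hPQ))
    refine ⟨x, ?_⟩
    have h2 : ENNReal.ofReal t < P x / Q := by
      rw [ENNReal.lt_div_iff_mul_lt (Or.inl hQ0) (Or.inl hQt)]; exact hx
    have h3 := (ENNReal.toReal_lt_toReal ENNReal.ofReal_ne_top hPt).2 h2
    exact lt_of_le_of_lt (by rw [ENNReal.toReal_ofReal']; exact le_max_left _ _) h3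
  have main := pl_norm (f := fun x => (F x / M).toReal) (g := fun x => (G x / N).toReal)
    (h := fun x => (min (H x / c) 1).toReal)
    (hF.div_const _).ennreal_toReal (hG.div_const _).ennreal_toReal
    ((hH.div_const _).min measurable_const).ennreal_toReal
    (fun _ => toReal_nonneg) (fun _ => toReal_nonneg) (fun _ => toReal_nonneg)
    (fun x => by simpa using ENNReal.toReal_mono one_ne_top (Fd x))
    (fun x => by simpa using ENNReal.toReal_mono one_ne_top (Gd x))
    (aux F M hM M0 Mt) (aux G N hN N0 Nt) ha hb (by
      intro x y
      rw [← ENNReal.toReal_min (Fdt x) (Gdt y)]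
      refine ENNReal.toReal_mono (Hdt _) (le_min ?_ ((min_le_left _ _).trans (Fd x)))
      calc min (F x / M) (G y / N) = min (F x / M) (G y / N) ^ a * min (F x / M) (G y / N) ^ b := by
            rw [← ENNReal.rpow_add_of_nonneg _ _ ha.le hb.le, hab, ENNReal.rpow_one]
        _ ≤ (F x / M) ^ a * (G y / N) ^ b := by
            gcongr
            · exact min_le_left _ _
            · exact min_le_right _ _
        _ = (F x ^ a * G y ^ b) / c := by
            rw [ENNReal.div_rpow_of_nonneg _ _ ha.le, ENNReal.div_rpow_of_nonneg _ _ hb.le,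
              hc, ENNReal.mul_div_mul_comm]
            · left; simp [ENNReal.rpow_eq_zero_iff, N0, Nt, M0, Mt]
            · left; simp [ENNReal.rpow_eq_zero_iff, N0, Nt, M0, Mt]
        _ ≤ H (a * x + b * y) / c := by gcongr; exact hyp x y)
  simp only [ENNReal.ofReal_toReal (Fdt _), ENNReal.ofReal_toReal (Gdt _),
    ENNReal.ofReal_toReal (Hdt _)] at main
  have eF : ∫⁻ x, F x = M * ∫⁻ x, F x / M := by
    rw [← lintegral_const_mul _ (hF.div_const _)]
    exact lintegral_congr fun x => (ENNReal.mul_div_cancel M0 Mt).symm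
  have eG : ∫⁻ x, G x = N * ∫⁻ x, G x / N := by
    rw [← lintegral_const_mul _ (hG.div_const _)]
    exact lintegral_congr fun x => (ENNReal.mul_div_cancel N0 Nt).symm
  rw [eF, eG, ENNReal.mul_rpow_of_nonneg _ _ ha.le, ENNReal.mul_rpow_of_nonneg _ _ hb.le]
  calc _ = c * ((∫⁻ x, F x / M) ^ a * (∫⁻ x, G x / N) ^ b) := by rw [hc]; ring
    _ ≤ c * ∫⁻ x, min (H x / c) 1 := by
        gcongr
        exact (ennreal_amgm _ _ ha hb hab).trans main
    _ ≤ c * ∫⁻ x, H x / c := by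
        gcongr
        exact min_le_left _ _
    _ = ∫⁻ x, H x := by
        rw [← lintegral_const_mul _ (hH.div_const _)]
        exact lintegral_congr fun x => ENNReal.mul_div_cancel c0 ct

open ENNReal in
lemma pl_one {F G H : ℝ → ℝ≥0∞} (hF : Measurable F) (hG : Measurable G) (hH : Measurable H)
    {a b : ℝ} (ha : 0 < a) (hb : 0 < b) (hab : a + b = 1)
    (hyp : ∀ x y, F x ^ a * G y ^ b ≤ H (a * x + b * y)) :
    (∫⁻ x, F x) ^ a * (∫⁻ x, G x) ^ b ≤ ∫⁻ x, H x := by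
  have aux : ∀ (P : ℝ → ℝ≥0∞), Measurable P → Tendsto (fun k : ℕ => ∫⁻ x, min (P x) k) atTop
      (nhds (∫⁻ x, P x)) := by
    intro P hP
    refine lintegral_tendsto_of_tendsto_of_monotone
      (fun k => (hP.min measurable_const).aemeasurable) ?_ ?_
    · refine Eventually.of_forall fun x m n hmn => ?_
      exact min_le_min_left _ (by exact_mod_cast hmn)
    · refine Eventually.of_forall fun x => ?_
      have : Tendsto (fun k : ℕ => min (P x) (k : ℝ≥0∞)) atTop (nhds (min (P x) ∞)) :=
        tendsto_const_nhds.min ENNReal.tendsto_nat_nhds_top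
      simpa using this
  have step : ∀ k : ℕ, (∫⁻ x, min (F x) k) ^ a * (∫⁻ x, min (G x) k) ^ b ≤ ∫⁻ x, H x := by
    intro k
    refine pl_bdd (hF.min measurable_const) (hG.min measurable_const) hH (k := k) (by simp)
      (fun x => min_le_right _ _) (fun x => min_le_right _ _) ha hb hab ?_
    intro x y
    refine le_trans ?_ (hyp x y)
    gcongr <;> exact min_le_left _ _
  by_cases F0 : ∫⁻ x, F x = 0
  · simp [F0, ENNReal.zero_rpow_of_pos ha]
  by_cases G0 : ∫⁻ x, G x = 0
  · simp [G0, ENNReal.zero_rpow_of_pos hb]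
  refine le_of_tendsto' (ENNReal.Tendsto.mul
    ((ENNReal.continuous_rpow_const (y := a)).continuousAt.tendsto.comp (aux F hF)) ?_
    ((ENNReal.continuous_rpow_const (y := b)).continuousAt.tendsto.comp (aux G hG)) ?_) step
  · left; simp [ENNReal.rpow_eq_zero_iff, F0, ha, ha.le, not_lt.2 ha.le]
  · left; simp [ENNReal.rpow_eq_zero_iff, G0, hb, hb.le, not_lt.2 hb.le]

open ENNReal in
lemma pl_pi : ∀ (n : ℕ) {F G H : (Fin n → ℝ) → ℝ≥0∞} (_ : Measurable F) (_ : Measurable G)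
    (_ : Measurable H) {a b : ℝ} (_ : 0 < a) (_ : 0 < b) (_ : a + b = 1)
    (_ : ∀ x y, F x ^ a * G y ^ b ≤ H (a • x + b • y)),
    (∫⁻ x, F x) ^ a * (∫⁻ x, G x) ^ b ≤ ∫⁻ x, H x := by
  intro n
  induction n with
  | zero =>
    intro F G H hF hG hH a b ha hb hab hyp
    have : ∀ P : (Fin 0 → ℝ) → ℝ≥0∞, ∫⁻ x, P x = P 0 := by
      intro P
      rw [volume_pi, Measure.pi_of_empty _ 0, lintegral_dirac]
    rw [this, this, this]
    simpa using hyp 0 0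
  | succ n ih =>
    intro F G H hF hG hH a b ha hb hab hyp
    have e := (volume_preserving_piFinSuccAbove (fun _ : Fin (n + 1) => ℝ) 0).symm
    set E := (MeasurableEquiv.piFinSuccAbove (fun _ : Fin (n + 1) => ℝ) 0).symm with hE
    have red : ∀ P : (Fin (n + 1) → ℝ) → ℝ≥0∞, Measurable P →
        ∫⁻ x, P x = ∫⁻ s : ℝ, ∫⁻ y : Fin n → ℝ, P (E (s, y)) := by
      intro P hP
      rw [← e.lintegral_comp hP]
      exact lintegral_prod _ (hP.comp E.measurable).aemeasurable
    have mea : ∀ P : (Fin (n + 1) → ℝ) → ℝ≥0∞, Measurable P →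
        Measurable fun s : ℝ => ∫⁻ y : Fin n → ℝ, P (E (s, y)) := by
      intro P hP
      exact (hP.comp E.measurable).lintegral_prod_right'
    have mea2 : ∀ P : (Fin (n + 1) → ℝ) → ℝ≥0∞, Measurable P → ∀ s,
        Measurable fun y : Fin n → ℝ => P (E (s, y)) := by
      intro P hP s
      exact (hP.comp E.measurable).comp measurable_prodMk_left
    rw [red F hF, red G hG, red H hH]
    refine pl_one (mea F hF) (mea G hG) (mea H hH) ha hb hab ?_
    intro s t
    refine ih (mea2 F hF s) (mea2 G hG t) (mea2 H hH _) ha hb hab ?_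
    intro x y
    refine (hyp _ _).trans (le_of_eq ?_)
    congr 1
    ext i
    refine Fin.cases ?_ (fun j => ?_) i <;> simp [hE, MeasurableEquiv.piFinSuccAbove, Fin.insertNthEquiv]

open ENNReal in
lemma pl_euc (n : ℕ) {F G H : EuclideanSpace ℝ (Fin n) → ℝ≥0∞} (hF : Measurable F)
    (hG : Measurable G) (hH : Measurable H) {a b : ℝ} (ha : 0 < a) (hb : 0 < b) (hab : a + b = 1)
    (hyp : ∀ x y, F x ^ a * G y ^ b ≤ H (a • x + b • y)) :
    (∫⁻ x, F x) ^ a * (∫⁻ x, G x) ^ b ≤ ∫⁻ x, H x := by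
  have e := (PiLp.volume_preserving_toLp (Fin n))
  rw [← e.lintegral_comp hF, ← e.lintegral_comp hG, ← e.lintegral_comp hH]
  refine pl_pi n (hF.comp e.measurable) (hG.comp e.measurable) (hH.comp e.measurable) ha hb hab ?_
  intro x y
  exact hyp _ _


lemma tail_moments (ν : Measure ℝ) [IsFiniteMeasure ν] (hx1 : Integrable (fun y => y) ν)
    {r p : ℝ} (hr : 0 < r) (hp : p = ν.real (Ici 0))
    (h1 : ∀ y, 0 ≤ y → ν.real (Ici y) ≤ p * Real.exp (-(r / p) * y))
    (h2 : ∀ x y, 0 ≤ x → 0 ≤ y → ν.real (Ici (x + y)) * p ≤ ν.real (Ici x) * ν.real (Ici y)) :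
    ∃ α, 0 ≤ α ∧ α ≤ p / r ∧ ∫ y, max y 0 ∂ν = p * α ∧
      ∫ y, (max y 0) ^ 2 ∂ν ≤ 2 * p * α ^ 2 := by
  have hp0 : 0 ≤ p := hp ▸ measureReal_nonneg
  rcases hp0.eq_or_lt with h0 | hp0
  · have hz : ν (Ici 0) = 0 := by
      rw [← h0] at hp
      simpa [measureReal_def, ENNReal.toReal_eq_zero_iff] using hp.symm
    have hae : ∀ᵐ y ∂ν, max y 0 = 0 := by
      have : ∀ᵐ y ∂ν, y ∉ Ici (0 : ℝ) := measure_eq_zero_iff_ae_notMem.1 hz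
      filter_upwards [this] with y hy
      simp at hy
      exact max_eq_right hy.le
    refine ⟨0, le_rfl, by rw [← h0]; simp, ?_, ?_⟩
    · rw [integral_congr_ae hae]; simp
    · have : ∀ᵐ y ∂ν, (max y 0) ^ 2 = (0 : ℝ) := by
        filter_upwards [hae] with y hy; simp [hy]
      rw [integral_congr_ae this]; simp
  set G : ℝ → ℝ := fun y => ν.real (Ici y) with hG
  have Ganti : Antitone G := fun x y hxy => measureReal_mono (Ici_subset_Ici.2 hxy)
  have G0 : ∀ y, 0 ≤ G y := fun y => measureReal_nonneg
  have hrp : -(r / p) < 0 := by have := div_pos hr hp0; linarith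
  have eI : IntegrableOn (fun y => p * Real.exp (-(r / p) * y)) (Ioi 0) :=
    (integrableOn_exp_mul_Ioi hrp 0).const_mul p
  have GI : IntegrableOn G (Ioi 0) := by
    refine Integrable.mono' eI Ganti.measurable.aestronglyMeasurable ?_
    refine (ae_restrict_iff' measurableSet_Ioi).2 (Eventually.of_forall fun y hy => ?_)
    rw [Real.norm_of_nonneg (G0 y)]
    exact h1 y (le_of_lt hy)
  have shift : ∀ x, 0 ≤ x → ∫ y, max (y - x) 0 ∂ν = ∫ t in Ioi 0, G (x + t) := by
    intro x hx
    have hi : Integrable (fun y => max (y - x) 0) ν :=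
      (hx1.sub (integrable_const x)).pos_part
    rw [hi.integral_eq_integral_meas_le (Eventually.of_forall fun y => le_max_right _ _)]
    refine setIntegral_congr_fun measurableSet_Ioi fun t ht => ?_
    simp only [hG]
    congr 1
    ext y
    simp only [mem_setOf_eq, mem_Ici, le_max_iff]
    simp only [mem_Ioi] at ht
    constructor
    · rintro (h | h) <;> linarith
    · intro h; left; linarith
  set A := ∫ t in Ioi 0, G t with hA
  have hA0 : 0 ≤ A := integral_nonneg G0
  have hA1 : ∫ y, max y 0 ∂ν = A := by simpa using shift 0 le_rfl
  have hAle : A ≤ p * (p / r) := by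
    have : A ≤ ∫ t in Ioi 0, p * Real.exp (-(r / p) * t) := by
      refine setIntegral_mono_on GI eI measurableSet_Ioi fun y hy => h1 y (le_of_lt hy)
    rw [integral_const_mul, integral_exp_mul_Ioi hrp] at this
    refine this.trans (le_of_eq ?_)
    simp
  have sh2 : ∀ x, 0 ≤ x → ∫ y, max (y - x) 0 ∂ν ≤ G x * (A / p) := by
    intro x hx
    rw [shift x hx, hA, mul_div_assoc', le_div_iff₀ hp0, ← integral_mul_const,
      ← integral_const_mul]
    refine setIntegral_mono_on ?_ (GI.const_mul _) measurableSet_Ioi fun y hy =>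
      h2 x y hx (le_of_lt hy)
    refine Integrable.mul_const ?_ _
    refine Integrable.mono' GI
      (Ganti.measurable.comp (measurable_const.add measurable_id)).aestronglyMeasurable ?_
    refine Eventually.of_forall fun y => ?_
    rw [Real.norm_of_nonneg (G0 _)]
    exact Ganti (by simpa using hx)
  refine ⟨A / p, by positivity, by rw [div_le_iff₀ hp0]; linarith, by rw [hA1]; field_simp, ?_⟩
  have lin : ∫⁻ y, ENNReal.ofReal ((max y 0) ^ 2) ∂ν ≤ ENNReal.ofReal (2 * p * (A / p) ^ 2) := by
    calc ∫⁻ y, ENNReal.ofReal ((max y 0) ^ 2) ∂ν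
        ≤ ∫⁻ y, (∫⁻ x in Ioi (0 : ℝ), ENNReal.ofReal (2 * max (y - x) 0)) ∂ν := by
          refine lintegral_mono fun y => ?_
          rcases le_or_gt y 0 with hy | hy
          · simp [max_eq_right hy]
          · refine le_trans ?_ (lintegral_mono_set (Ioc_subset_Ioi_self : Ioc 0 y ⊆ Ioi 0))
            have e1 : ∫ x in Ioc 0 y, 2 * max (y - x) 0 = y ^ 2 := by
              have : ∫ x in Ioc 0 y, 2 * max (y - x) 0 = ∫ x in Ioc 0 y, 2 * (y - x) :=
                setIntegral_congr_fun measurableSet_Ioc fun x hx => by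
                  rw [max_eq_left (by linarith [hx.2])]
              rw [this, ← intervalIntegral.integral_of_le hy.le]
              rw [intervalIntegral.integral_const_mul, intervalIntegral.integral_sub
                intervalIntegrable_const intervalIntegral.intervalIntegrable_id, integral_id,
                intervalIntegral.integral_const]
              simp only [smul_eq_mul]
              ring
            rw [max_eq_left hy.le, ← e1, ofReal_integral_eq_lintegral_ofReal]
            · exact (Continuous.integrableOn_Icc (by fun_prop)).mono_set Ioc_subset_Icc_self
            · exact Eventually.of_forall fun x => by positivity
      _ = ∫⁻ x in Ioi (0 : ℝ), (∫⁻ y, ENNReal.ofReal (2 * max (y - x) 0) ∂ν) := by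
          refine lintegral_lintegral_swap (Measurable.aemeasurable ?_)
          simp only [Function.uncurry_def]
          fun_prop
      _ ≤ ∫⁻ x in Ioi (0 : ℝ), ENNReal.ofReal (2 * (G x * (A / p))) := by
          refine setLIntegral_mono' measurableSet_Ioi fun x hx => ?_
          rw [← ofReal_integral_eq_lintegral_ofReal, integral_const_mul]
          · have := sh2 x (le_of_lt hx)
            gcongr
          · exact ((hx1.sub (integrable_const x)).pos_part).const_mul 2
          · exact Eventually.of_forall fun x => by positivity
      _ = ENNReal.ofReal (2 * p * (A / p) ^ 2) := by
          rw [← ofReal_integral_eq_lintegral_ofReal, integral_const_mul, integral_mul_const, ← hA]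
          · congr 1; field_simp
          · exact (GI.mul_const _).const_mul 2
          · exact Eventually.of_forall fun x => by have := G0 x; positivity
  rw [integral_eq_lintegral_of_nonneg_ae (Eventually.of_forall fun y => by positivity)
    (by fun_prop)]
  exact ENNReal.toReal_le_of_le_ofReal (by positivity) lin

lemma lc_submul {G : ℝ → ℝ} (G0 : ∀ x, 0 ≤ G x)
    (hG : ∀ a b x y : ℝ, 0 < a → 0 < b → a + b = 1 → G x ^ a * G y ^ b ≤ G (a * x + b * y)) :
    ∀ x y, 0 ≤ x → 0 ≤ y → G (x + y) * G 0 ≤ G x * G y := by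
  intro x y hx hy
  rcases hx.eq_or_lt with rfl | hx
  · simp [mul_comm]
  rcases hy.eq_or_lt with rfl | hy
  · simp
  have hs : 0 < x + y := by positivity
  have hab : x / (x + y) + y / (x + y) = 1 := by field_simp
  have h1 := hG (x / (x + y)) (y / (x + y)) (x + y) 0 (by positivity) (by positivity) hab
  have h2 := hG (y / (x + y)) (x / (x + y)) (x + y) 0 (by positivity) (by positivity)
    (by rw [add_comm]; exact hab)
  have e1 : x / (x + y) * (x + y) + y / (x + y) * 0 = x := by field_simp; ring
  have e2 : y / (x + y) * (x + y) + x / (x + y) * 0 = y := by field_simp; ring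
  rw [e1] at h1
  rw [e2] at h2
  refine le_trans (le_of_eq ?_) (mul_le_mul h1 h2 (by have := G0 (x+y); have := G0 0; positivity) (G0 _))
  calc G (x + y) * G 0 = (G (x+y) ^ (x / (x+y)) * G (x+y) ^ (y/(x+y))) *
        (G 0 ^ (x / (x+y)) * G 0 ^ (y/(x+y))) := by
        rw [← Real.rpow_add_of_nonneg (G0 _) (by positivity) (by positivity),
          ← Real.rpow_add_of_nonneg (G0 _) (by positivity) (by positivity), hab,
          Real.rpow_one, Real.rpow_one]
    _ = _ := by ring

lemma lc_log {G : ℝ → ℝ}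
    (hG : ∀ a b x y : ℝ, 0 < a → 0 < b → a + b = 1 → G x ^ a * G y ^ b ≤ G (a * x + b * y))
    {a b x y : ℝ} (ha : 0 < a) (hb : 0 < b) (hab : a + b = 1) (hx : 0 < G x) (hy : 0 < G y) :
    a * Real.log (G x) + b * Real.log (G y) ≤ Real.log (G (a * x + b * y)) := by
  have := Real.log_le_log (by positivity) (hG a b x y ha hb hab)
  rwa [Real.log_mul (by positivity) (by positivity), Real.log_rpow hx, Real.log_rpow hy] at this

lemma lc_right {G : ℝ → ℝ} (G0 : ∀ x, 0 ≤ G x)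
    (hG : ∀ a b x y : ℝ, 0 < a → 0 < b → a + b = 1 → G x ^ a * G y ^ b ≤ G (a * x + b * y))
    {r : ℝ} (hr : 0 < r) (hs : ∀ᶠ s in nhdsWithin (0:ℝ) (Ioi 0), G s ≤ G 0 - r * s) :
    ∀ y, 0 ≤ y → G y ≤ G 0 * Real.exp (-(r / G 0) * y) := by
  intro y hy
  rcases hy.eq_or_lt with rfl | hy
  · simp
  obtain ⟨s, hs, hsy, hs0⟩ := (hs.and ((Ioo_mem_nhdsGT hy))).exists
  have hs0' : 0 < s := hsy
  have hp : 0 < G 0 := by have := G0 s; nlinarith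
  rcases (G0 y).eq_or_lt with h | hGy
  · rw [← h]; positivity
  have h1 := lc_log hG (a := s / y) (b := 1 - s / y) (x := y) (y := 0) (by positivity)
    (by rw [sub_pos, div_lt_one hy]; exact hs0) (by ring) hGy hp
  have e : s / y * y + (1 - s / y) * 0 = s := by field_simp; ring
  rw [e] at h1
  have hGs : 0 < G s := by
    have := hG (s / y) (1 - s / y) y 0 (by positivity)
      (by rw [sub_pos, div_lt_one hy]; exact hs0) (by ring)
    rw [e] at this
    exact lt_of_lt_of_le (by positivity) this
  have h2 : Real.log (G s) ≤ Real.log (G 0) - r * s / G 0 := by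
    have h3 := Real.log_le_sub_one_of_pos (x := G s / G 0) (by positivity)
    rw [Real.log_div hGs.ne' hp.ne'] at h3
    have : G s / G 0 ≤ 1 - r * s / G 0 := by
      rw [div_le_iff₀ hp]; field_simp; linarith
    linarith
  have h4 : s / y * (Real.log (G y) - Real.log (G 0)) ≤ - (r * s / G 0) := by linarith
  have h5 : Real.log (G y) - Real.log (G 0) ≤ -(r / G 0) * y := by
    have : s / y * (Real.log (G y) - Real.log (G 0)) ≤ s / y * (-(r / G 0) * y) := by
      refine h4.trans (le_of_eq ?_); field_simp
    exact le_of_mul_le_mul_left this (by positivity)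
  rw [← Real.log_le_log_iff hGy (by positivity), Real.log_mul hp.ne' (Real.exp_pos _).ne',
    Real.log_exp]
  linarith

lemma lc_left {G : ℝ → ℝ} (G0 : ∀ x, 0 ≤ G x) (Ga : Antitone G)
    (hG : ∀ a b x y : ℝ, 0 < a → 0 < b → a + b = 1 → G x ^ a * G y ^ b ≤ G (a * x + b * y))
    {r : ℝ} (hr : 0 < r) (hs : ∀ᶠ s in nhdsWithin (0:ℝ) (Ioi 0), G 0 + r * s ≤ G (-s)) :
    ∀ y, 0 ≤ y → G y ≤ G 0 * Real.exp (-(r / G 0) * y) := by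
  intro y hy
  rcases hy.eq_or_lt with rfl | hy
  · simp
  rcases (G0 0).eq_or_lt with h | hp
  · have := Ga hy.le; rw [← h] at this ⊢; simpa using this
  rcases (G0 y).eq_or_lt with h | hGy
  · rw [← h]; positivity
  have key : ∀ᶠ s in nhdsWithin (0:ℝ) (Ioi 0),
      Real.log (G y) - Real.log (G 0) ≤ -(r / (G 0 + r * s)) * y := by
    filter_upwards [hs, self_mem_nhdsWithin] with s hs hs0
    have hs0' : 0 < s := hs0
    have hq : 0 < G 0 + r * s := by positivity
    have hGs : 0 < G (-s) := by linarith
    have h1 := lc_log hG (a := s / (s + y)) (b := y / (s + y)) (x := y) (y := -s) (by positivity)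
      (by positivity) (by field_simp) hGy hGs
    have e : s / (s + y) * y + y / (s + y) * (-s) = 0 := by field_simp; ring
    rw [e] at h1
    have h2 : Real.log (G 0 + r * s) ≤ Real.log (G (-s)) := Real.log_le_log hq hs
    have h3 := Real.log_le_sub_one_of_pos (x := G 0 / (G 0 + r * s)) (by positivity)
    rw [Real.log_div hp.ne' hq.ne'] at h3
    have h3' : G 0 / (G 0 + r * s) - 1 = - (r * s / (G 0 + r * s)) := by field_simp; ring
    have h4 : s * Real.log (G y) + y * Real.log (G (-s)) ≤ (s + y) * Real.log (G 0) := by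
      have hsy : 0 < s + y := by positivity
      have := mul_le_mul_of_nonneg_left h1 hsy.le
      refine le_trans (le_of_eq ?_) this
      field_simp
    have h5 : y * (Real.log (G 0) - Real.log (G (-s))) ≤ y * (-(r * s / (G 0 + r * s))) :=
      mul_le_mul_of_nonneg_left (by linarith) hy.le
    have h6 : s * (Real.log (G y) - Real.log (G 0)) ≤ s * (-(r / (G 0 + r * s)) * y) := by
      refine le_trans ?_ (h5.trans (le_of_eq ?_))
      · linarith
      · field_simp
    exact le_of_mul_le_mul_left h6 hs0'
  have lim : Tendsto (fun s => -(r / (G 0 + r * s)) * y) (nhdsWithin (0:ℝ) (Ioi 0))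
      (nhds (-(r / (G 0 + r * 0)) * y)) := by
    have : ContinuousAt (fun s => -(r / (G 0 + r * s)) * y) 0 := by
      have : G 0 + r * 0 ≠ 0 := by simpa using hp.ne'
      fun_prop (disch := assumption)
    exact this.tendsto.mono_left nhdsWithin_le_nhds
  have h5 := ge_of_tendsto lim key
  simp only [mul_zero, add_zero] at h5
  rw [← Real.log_le_log_iff hGy (by positivity), Real.log_mul hp.ne' (Real.exp_pos _).ne',
    Real.log_exp]
  linarith


lemma cdf_cont (ν : Measure ℝ) [IsProbabilityMeasure ν] [NullSingletonClass ν] :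
    Continuous fun x => ν.real (Iic x) := by
  have h : (fun x => ν.real (Iic x)) = fun x => ProbabilityTheory.cdf ν x := by
    ext x; rw [ProbabilityTheory.cdf_eq_real]
  rw [h, continuous_iff_continuousAt]
  intro x
  rw [(ProbabilityTheory.cdf ν).mono.continuousAt_iff_leftLim_eq_rightLim,
    (ProbabilityTheory.cdf ν).rightLim_eq]
  have h1 := StieltjesFunction.measure_singleton (ProbabilityTheory.cdf ν) x
  rw [ProbabilityTheory.measure_cdf, measure_singleton] at h1
  have h2 := (ProbabilityTheory.cdf ν).mono.leftLim_le (le_refl x)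
  have h3 := ENNReal.ofReal_eq_zero.1 h1.symm
  linarith

lemma var_algebra {p q α β r : ℝ} (hp : 0 ≤ p) (hq : 0 ≤ q) (hpq : p + q = 1) (hr : 1 < r)
    (a0 : 0 ≤ α) (b0 : 0 ≤ β) (ha : α ≤ p / r) (hb : β ≤ q / r) :
    2 * p * α ^ 2 + 2 * q * β ^ 2 - (p * α - q * β) ^ 2 < 1 := by
  have hr0 : 0 < r := by linarith
  have hpr : p / r ≤ p := div_le_self hp hr.le
  have hqr : q / r ≤ q := div_le_self hq hr.le
  have e : 2 * p * α ^ 2 + 2 * q * β ^ 2 - (p * α - q * β) ^ 2 =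
    p * (2 - p) * α ^ 2 + q * (2 - q) * β ^ 2 + 2 * (p * q) * (α * β) := by ring
  have h1 : α ^ 2 ≤ (p / r) ^ 2 := by gcongr
  have h2 : β ^ 2 ≤ (q / r) ^ 2 := by gcongr
  have h3 : α * β ≤ (p / r) * (q / r) := by gcongr
  have p2 : 0 ≤ p * (2 - p) := mul_nonneg hp (by linarith)
  have q2 : 0 ≤ q * (2 - q) := mul_nonneg hq (by linarith)
  have pq : 0 ≤ 2 * (p * q) := by positivity
  rw [e]
  have f1 := mul_le_mul_of_nonneg_left h1 p2
  have f2 := mul_le_mul_of_nonneg_left h2 q2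
  have f3 := mul_le_mul_of_nonneg_left h3 pq
  have e2 : p * (2 - p) * (p / r) ^ 2 + q * (2 - q) * (q / r) ^ 2 + 2 * (p * q) * (p / r * (q / r))
      = (1 - 2 * (p * q)) / r ^ 2 := by
    have : q = 1 - p := by linarith
    subst this
    field_simp
    ring
  have e3 : (1 - 2 * (p * q)) / r ^ 2 < 1 := by
    rw [div_lt_one (by positivity)]
    nlinarith [mul_nonneg hp hq]
  linarith

lemma slab_one (ν : Measure ℝ) [IsProbabilityMeasure ν] [NullSingletonClass ν]
    (hx2 : Integrable (fun y => y ^ 2) ν) (hx1 : Integrable (fun y => y) ν)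
    (m1 : ∫ y, y ∂ν = 0) (m2 : ∫ y, y ^ 2 ∂ν = 1)
    (hT : ∀ a b x y : ℝ, 0 < a → 0 < b → a + b = 1 →
      ν.real (Ici x) ^ a * ν.real (Ici y) ^ b ≤ ν.real (Ici (a * x + b * y)))
    (hS : ∀ a b x y : ℝ, 0 < a → 0 < b → a + b = 1 →
      ν.real (Iic x) ^ a * ν.real (Iic y) ^ b ≤ ν.real (Iic (a * x + b * y)))
    {a b : ℝ} (hab : a ≤ b) : ν.real (Icc a b) ≤ b - a := by
  have main := image_le_of_liminf_slope_right_le_deriv_boundary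
    (f := fun x => ν.real (Iic x)) (a := a) (b := b) (cdf_cont ν).continuousOn
    (B := fun x => ν.real (Iic a) + (x - a)) (B' := fun _ => 1) (by simp) (by fun_prop)
    (fun x _ => (((hasDerivAt_id x).sub_const a).const_add _).hasDerivWithinAt) (by
      intro c hc r hr
      by_contra hcon
      rw [not_frequently] at hcon
      have hTS : ∀ x, ν.real (Ici x) = 1 - ν.real (Iic x) := by
        intro x
        have h1 : ν.real (Ici x) = ν.real (Ioi x) := measureReal_congr Ioi_ae_eq_Ici.symm
        rw [h1, ← compl_Iic, probReal_compl_eq_one_sub measurableSet_Iic]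
      have ev : ∀ᶠ s in nhdsWithin (0:ℝ) (Ioi 0),
          ν.real (Iic c) + r * s ≤ ν.real (Iic (c + s)) := by
        have ht : Tendsto (fun s => c + s) (nhdsWithin (0:ℝ) (Ioi 0)) (nhdsWithin c (Ioi c)) := by
          refine tendsto_nhdsWithin_iff.2 ⟨?_, ?_⟩
          · have : Tendsto (fun s => c + s) (nhds (0:ℝ)) (nhds (c + 0)) :=
              (continuous_const.add continuous_id).tendsto 0
            rw [add_zero] at this
            exact this.mono_left nhdsWithin_le_nhds
          · filter_upwards [self_mem_nhdsWithin] with s hs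
            simpa using hs
        filter_upwards [ht.eventually hcon, self_mem_nhdsWithin] with s hs hs0
        have hs0' : 0 < s := hs0
        rw [slope_def_field, not_lt, add_sub_cancel_left, le_div_iff₀ hs0'] at hs
        linarith
      have hr0 : 0 < r := by linarith
      have mR : Measurable fun y : ℝ => y - c := by fun_prop
      have mL : Measurable fun y : ℝ => c - y := by fun_prop
      have R1 : ∀ y, (ν.map fun y => y - c).real (Ici y) = ν.real (Ici (c + y)) := by
        intro y
        rw [map_measureReal_apply mR measurableSet_Ici]
        congr 1; ext z; simp [add_comm, le_sub_iff_add_le]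
      have L1 : ∀ y, (ν.map fun y => c - y).real (Ici y) = ν.real (Iic (c - y)) := by
        intro y
        rw [map_measureReal_apply mL measurableSet_Ici]
        congr 1; ext z; simp only [mem_preimage, mem_Ici, mem_Iic]; constructor <;> intro h <;> linarith
      have lcR : ∀ a b x y : ℝ, 0 < a → 0 < b → a + b = 1 →
          ν.real (Ici (c + x)) ^ a * ν.real (Ici (c + y)) ^ b ≤
            ν.real (Ici (c + (a * x + b * y))) := by
        intro a b x y ha hb hab
        refine (hT a b _ _ ha hb hab).trans (le_of_eq ?_)
        congr 2
        have : b = 1 - a := by linarith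
        subst this; ring
      have lcL : ∀ a b x y : ℝ, 0 < a → 0 < b → a + b = 1 →
          ν.real (Iic (c - x)) ^ a * ν.real (Iic (c - y)) ^ b ≤
            ν.real (Iic (c - (a * x + b * y))) := by
        intro a b x y ha hb hab
        refine (hS a b _ _ ha hb hab).trans (le_of_eq ?_)
        congr 2
        have : b = 1 - a := by linarith
        subst this; ring
      have tR := lc_right (G := fun y => ν.real (Ici (c + y))) (fun _ => measureReal_nonneg) lcR hr0
        (by filter_upwards [ev] with s hs
            simp only [add_zero]
            rw [hTS, hTS]; linarith)
      have tL := lc_left (G := fun y => ν.real (Iic (c - y))) (fun _ => measureReal_nonneg)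
        (fun x y hxy => measureReal_mono (Iic_subset_Iic.2 (by linarith))) lcL hr0
        (by filter_upwards [ev] with s hs
            simpa using hs)
      have sR := lc_submul (G := fun y => ν.real (Ici (c + y))) (fun _ => measureReal_nonneg) lcR
      have sL := lc_submul (G := fun y => ν.real (Iic (c - y))) (fun _ => measureReal_nonneg) lcL
      have : IsFiniteMeasure (ν.map fun y => y - c) := inferInstance
      have iR : Integrable (fun y => y - c) ν := hx1.sub (integrable_const c)
      have iL : Integrable (fun y => c - y) ν := (integrable_const c).sub hx1
      obtain ⟨α, α0, α1, α2, α3⟩ := tail_moments (ν.map fun y => y - c)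
        ((integrable_map_measure (by fun_prop) mR.aemeasurable).2 iR) hr0 rfl
        (by intro y hy; simp only [R1]; exact tR y hy)
        (by intro x y hx hy; simp only [R1]; exact sR x y hx hy)
      obtain ⟨β, β0, β1, β2, β3⟩ := tail_moments (ν.map fun y => c - y)
        ((integrable_map_measure (by fun_prop) mL.aemeasurable).2 iL) hr0 rfl
        (by intro y hy; simp only [L1]; exact tL y hy)
        (by intro x y hx hy; simp only [L1]; exact sL x y hx hy)
      rw [integral_map mR.aemeasurable (by fun_prop)] at α2 α3
      rw [integral_map mL.aemeasurable (by fun_prop)] at β2 β3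
      simp only [R1, L1, add_zero, sub_zero] at α1 α2 α3 β1 β2 β3
      set p := ν.real (Ici c)
      set q := ν.real (Iic c)
      have hpq : p + q = 1 := by have := hTS c; linarith
      have va := var_algebra measureReal_nonneg measureReal_nonneg hpq hr α0 β0 α1 β1
      have i1 : ∫ y, (y - c) ∂ν = p * α - q * β := by
        rw [← α2, ← β2, ← integral_sub iR.pos_part iL.pos_part]
        refine integral_congr_ae (Eventually.of_forall fun y => ?_)
        simp only
        rcases le_total y c with h | h
        · rw [max_eq_right (by linarith), max_eq_left (by linarith)]; ring
        · rw [max_eq_left (by linarith), max_eq_right (by linarith)]; ring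
      have iR2 : Integrable (fun y => (y - c) ^ 2) ν := by
        have : (fun y : ℝ => (y - c) ^ 2) = fun y => (y ^ 2 - 2 * c * y) + c ^ 2 := by
          ext y; ring
        rw [this]
        exact (hx2.sub (hx1.const_mul _)).add (integrable_const _)
      have j1 : Integrable (fun y => (max (y - c) 0) ^ 2) ν := by
        refine iR2.mono' (by fun_prop) (Eventually.of_forall fun y => ?_)
        rw [Real.norm_of_nonneg (by positivity)]
        rcases le_total y c with h | h
        · rw [max_eq_right (by linarith)]; nlinarith
        · rw [max_eq_left (by linarith)]
      have j2 : Integrable (fun y => (max (c - y) 0) ^ 2) ν := by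
        refine iR2.mono' (by fun_prop) (Eventually.of_forall fun y => ?_)
        rw [Real.norm_of_nonneg (by positivity)]
        rcases le_total y c with h | h
        · rw [max_eq_left (by linarith)]; nlinarith
        · rw [max_eq_right (by linarith)]; nlinarith
      have i2 : ∫ y, (y - c) ^ 2 ∂ν = ∫ y, (max (y - c) 0) ^ 2 ∂ν + ∫ y, (max (c - y) 0) ^ 2 ∂ν := by
        rw [← integral_add j1 j2]
        refine integral_congr_ae (Eventually.of_forall fun y => ?_)
        simp only
        rcases le_total y c with h | h
        · rw [max_eq_right (by linarith), max_eq_left (by linarith)]; ring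
        · rw [max_eq_left (by linarith), max_eq_right (by linarith)]; ring
      have i3 : ∫ y, (y - c) ∂ν = - c := by
        rw [integral_sub hx1 (integrable_const c), m1]; simp
      have i4 : ∫ y, (y - c) ^ 2 ∂ν = 1 + c ^ 2 := by
        have : (fun y : ℝ => (y - c) ^ 2) = fun y => (y ^ 2 - 2 * c * y) + c ^ 2 := by
          ext y; ring
        rw [this, integral_add (f := fun y => y ^ 2 - 2 * c * y) (hx2.sub (hx1.const_mul _))
            (integrable_const _),
          integral_sub hx2 (hx1.const_mul _), integral_const_mul, m1, m2]
        simp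
      have i5 : (p * α - q * β) ^ 2 = c ^ 2 := by rw [← i1, i3]; ring
      linarith)
  have h := main (right_mem_Icc.2 hab)
  have h2 : ν.real (Icc a b) = ν.real (Iic b) - ν.real (Iic a) := by
    have h3 : ν.real (Icc a b) = ν.real (Ioc a b) := measureReal_congr Ioc_ae_eq_Icc.symm
    rw [h3, ← Iic_sdiff_Iic, measureReal_sdiff (Iic_subset_Iic.2 hab) measurableSet_Iic]
  linarith


lemma nice_density {n : ℕ} (f : Euc n → ℝ) (hf : IsLogConcaveFn f) :
    ∃ (g : Euc n → ℝ) (U : Set (Euc n)), IsOpen U ∧ Convex ℝ U ∧ (∀ x ∈ U, 0 < g x) ∧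
      (∀ x, x ∉ U → g x = 0) ∧ ConcaveOn ℝ U (fun x => Real.log (g x)) ∧ Measurable g ∧
      f =ᵐ[volume] g := by
  classical
  obtain ⟨hf0, hf1⟩ := hf
  set S : Set (Euc n) := {x | 0 < f x} with hS
  have hconv : Convex ℝ S := by
    intro x hx y hy a b ha hb hab
    have := hf1 x y a ha (by linarith)
    rw [show 1 - a = b by linarith] at this
    exact lt_of_lt_of_le (mul_pos (Real.rpow_pos_of_pos hx _) (Real.rpow_pos_of_pos hy _)) this
  have hlog : ConcaveOn ℝ S (fun x => Real.log (f x)) := by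
    refine ⟨hconv, ?_⟩
    intro x hx y hy a b ha hb hab
    have h := hf1 x y a ha (by linarith)
    rw [show 1 - a = b by linarith] at h
    have hx' : 0 < f x := hx
    have hy' : 0 < f y := hy
    have h2 := Real.log_le_log (mul_pos (Real.rpow_pos_of_pos hx' _) (Real.rpow_pos_of_pos hy' _)) h
    rw [Real.log_mul (Real.rpow_pos_of_pos hx' _).ne' (Real.rpow_pos_of_pos hy' _).ne',
      Real.log_rpow hx', Real.log_rpow hy'] at h2
    simpa using h2
  have hcl : ContinuousOn f (interior S) := by
    have h1 := hlog.continuousOn_interior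
    have h2 : ContinuousOn (fun x => Real.exp (Real.log (f x))) (interior S) := h1.rexp
    refine h2.congr ?_
    intro x hx
    have : 0 < f x := (interior_subset hx : x ∈ S)
    simp [Real.exp_log this]
  have hgU : ∀ x ∈ interior S, (interior S).indicator f x = f x := fun x hx => indicator_of_mem hx f
  refine ⟨(interior S).indicator f, interior S, isOpen_interior, hconv.interior, ?_, ?_, ?_, ?_, ?_⟩
  · intro x hx
    rw [hgU x hx]
    exact (interior_subset hx : x ∈ S)
  · intro x hx
    exact indicator_of_notMem hx f
  · refine (hlog.subset interior_subset hconv.interior).congr ?_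
    intro x hx
    simp only [hgU x hx]
  · have hm : Measurable ((interior S).piecewise f 0) := by
      refine ContinuousOn.measurable_piecewise hcl continuousOn_const isOpen_interior.measurableSet
    rwa [piecewise_eq_indicator] at hm
  · have h0 : volume (frontier S) = 0 := hconv.addHaar_frontier _
    have : ∀ᵐ x ∂(volume : Measure (Euc n)), x ∉ frontier S := measure_eq_zero_iff_ae_notMem.1 h0
    filter_upwards [this] with x hx
    by_cases hxi : x ∈ interior S
    · rw [hgU x hxi]
    · rw [indicator_of_notMem hxi]
      have : x ∉ S := fun hxs => hx ⟨subset_closure hxs, hxi⟩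
      have h2 : ¬ 0 < f x := this
      exact le_antisymm (not_lt.1 h2) (hf0 x)

lemma nice_lc {n : ℕ} {g : Euc n → ℝ} {U : Set (Euc n)} (hUc : Convex ℝ U)
    (hpos : ∀ x ∈ U, 0 < g x) (hz : ∀ x, x ∉ U → g x = 0)
    (hlog : ConcaveOn ℝ U (fun x => Real.log (g x))) (x y : Euc n) {a b : ℝ} (ha : 0 < a)
    (hb : 0 < b) (hab : a + b = 1) : g x ^ a * g y ^ b ≤ g (a • x + b • y) := by
  have h0 : ∀ z, 0 ≤ g z := fun z => by
    by_cases h : z ∈ U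
    · exact (hpos z h).le
    · exact (hz z h).ge
  by_cases hx : x ∈ U
  · by_cases hy : y ∈ U
    · have h := hlog.2 hx hy ha.le hb.le hab
      have hx' := hpos x hx
      have hy' := hpos y hy
      have hxy := hpos _ (hUc hx hy ha.le hb.le hab)
      rw [← Real.log_le_log_iff (mul_pos (Real.rpow_pos_of_pos hx' _) (Real.rpow_pos_of_pos hy' _)) hxy,
        Real.log_mul (Real.rpow_pos_of_pos hx' _).ne' (Real.rpow_pos_of_pos hy' _).ne',
        Real.log_rpow hx', Real.log_rpow hy']
      simpa using h
    · rw [hz y hy, Real.zero_rpow hb.ne', mul_zero]; exact h0 _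
  · rw [hz x hx, Real.zero_rpow ha.ne', zero_mul]; exact h0 _


lemma lc_measure {n : ℕ} {g : Euc n → ℝ} (hgm : Measurable g) (hg0 : ∀ x, 0 ≤ g x)
    (hlc : ∀ x y : Euc n, ∀ a b : ℝ, 0 < a → 0 < b → a + b = 1 → g x ^ a * g y ^ b ≤ g (a • x + b • y))
    (μ : Measure (Euc n)) [IsProbabilityMeasure μ]
    (hμ : μ = volume.withDensity (fun x => ENNReal.ofReal (g x)))
    {A B C : Set (Euc n)} (hA : MeasurableSet A) (hB : MeasurableSet B) (hC : MeasurableSet C)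
    {a b : ℝ} (ha : 0 < a) (hb : 0 < b) (hab : a + b = 1)
    (hABC : ∀ x ∈ A, ∀ y ∈ B, a • x + b • y ∈ C) :
    μ.real A ^ a * μ.real B ^ b ≤ μ.real C := by
  have hm : Measurable (fun x => ENNReal.ofReal (g x)) := hgm.ennreal_ofReal
  have e : ∀ S, MeasurableSet S → μ S = ∫⁻ x, S.indicator (fun x => ENNReal.ofReal (g x)) x := by
    intro S hS
    rw [hμ, withDensity_apply _ hS, lintegral_indicator hS]
  have key := pl_euc n (hm.indicator hA) (hm.indicator hB) (hm.indicator hC) ha hb hab ?_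
  · rw [← e A hA, ← e B hB, ← e C hC] at key
    have := ENNReal.toReal_mono (measure_ne_top μ C) key
    rwa [ENNReal.toReal_mul, ← ENNReal.toReal_rpow, ← ENNReal.toReal_rpow] at this
  · intro x y
    by_cases hx : x ∈ A
    · by_cases hy : y ∈ B
      · rw [indicator_of_mem hx, indicator_of_mem hy, indicator_of_mem (hABC x hx y hy),
          ENNReal.ofReal_rpow_of_nonneg (hg0 x) ha.le, ENNReal.ofReal_rpow_of_nonneg (hg0 y) hb.le,
          ← ENNReal.ofReal_mul (Real.rpow_nonneg (hg0 x) _)]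
        exact ENNReal.ofReal_le_ofReal (hlc x y a b ha hb hab)
      · rw [indicator_of_notMem hy, ENNReal.zero_rpow_of_pos hb, mul_zero]; exact zero_le
    · rw [indicator_of_notMem hx, ENNReal.zero_rpow_of_pos ha, zero_mul]; exact zero_le

/-- Integrability of coordinates products from the isotropy hypotheses. -/
lemma iso_memLp {n : ℕ} (μ : Measure (Euc n)) [IsProbabilityMeasure μ]
    (hiso : ∀ i j : Fin n, ∫ x, x i * x j ∂μ = if i = j then 1 else 0) (i : Fin n) :
    MemLp (fun x : Euc n => x i) 2 μ := by
  have hmeas : Measurable (fun x : Euc n => x i) := by fun_prop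
  rw [memLp_two_iff_integrable_sq hmeas.aestronglyMeasurable]
  by_contra h
  have h1 := hiso i i
  rw [if_pos rfl, integral_undef] at h1
  · exact zero_ne_one h1
  · intro h2
    apply h
    simpa [sq] using h2

lemma iso_inner_memLp {n : ℕ} (μ : Measure (Euc n)) [IsProbabilityMeasure μ]
    (hiso : ∀ i j : Fin n, ∫ x, x i * x j ∂μ = if i = j then 1 else 0) (u : Euc n) :
    MemLp (fun x : Euc n => inner ℝ u x) 2 μ := by
  have : (fun x : Euc n => inner ℝ u x) = fun x => ∑ i, u i * x i := by
    ext x; simp [PiLp.inner_apply, mul_comm]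
  rw [this]
  exact memLp_finset_sum _ fun i _ => (iso_memLp μ hiso i).const_mul (u i)

lemma iso_inner_sq {n : ℕ} (μ : Measure (Euc n)) [IsProbabilityMeasure μ]
    (hiso : ∀ i j : Fin n, ∫ x, x i * x j ∂μ = if i = j then 1 else 0) (u : Euc n) :
    ∫ x, (inner ℝ u x) ^ 2 ∂μ = ‖u‖ ^ 2 := by
  have : ∀ x : Euc n, (inner ℝ u x : ℝ) ^ 2 = ∑ i, ∑ j, u i * u j * (x i * x j) := by
    intro x
    rw [PiLp.inner_apply, sq, Finset.sum_mul_sum]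
    refine Finset.sum_congr rfl fun i _ => Finset.sum_congr rfl fun j _ => ?_
    simp; ring
  simp_rw [this]
  have hInt : ∀ i j, Integrable (fun x : Euc n => u i * u j * (x i * x j)) μ := fun i j =>
    ((iso_memLp μ hiso i).integrable_mul (iso_memLp μ hiso j)).const_mul _
  rw [integral_finset_sum _ fun i _ => integrable_finset_sum _ fun j _ => hInt i j]
  simp_rw [integral_finset_sum _ fun j _ => hInt _ j, integral_const_mul, hiso]
  rw [EuclideanSpace.norm_sq_eq]
  simp [sq]

lemma iso_int_id {n : ℕ} (μ : Measure (Euc n)) [IsProbabilityMeasure μ]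
    (hiso : ∀ i j : Fin n, ∫ x, x i * x j ∂μ = if i = j then 1 else 0) :
    Integrable (fun x : Euc n => x) μ := by
  have h : Integrable (fun x : Euc n => ∑ i, ‖x i‖) μ :=
    integrable_finset_sum _ fun i _ => ((iso_memLp μ hiso i).integrable (by norm_num)).norm
  refine h.mono' measurable_id.aestronglyMeasurable (ae_of_all _ fun x => ?_)
  calc ‖x‖ = ‖∑ i, x i • EuclideanSpace.single i (1:ℝ)‖ := by
        congr 1
        ext j
        simp [Finset.sum_apply, Pi.single_apply]
    _ ≤ _ := (norm_sum_le _ _).trans (by simp [norm_smul])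

lemma slab {n : ℕ} {g : Euc n → ℝ} (hgm : Measurable g) (hg0 : ∀ x, 0 ≤ g x)
    (hlc : ∀ x y : Euc n, ∀ a b : ℝ, 0 < a → 0 < b → a + b = 1 → g x ^ a * g y ^ b ≤ g (a • x + b • y))
    (μ : Measure (Euc n)) [IsProbabilityMeasure μ]
    (hμ : μ = volume.withDensity (fun x => ENNReal.ofReal (g x)))
    (hcent : ∫ x, x ∂μ = 0)
    (hiso : ∀ i j : Fin n, ∫ x, x i * x j ∂μ = if i = j then 1 else 0)
    (u : Euc n) (hu : ‖u‖ = 1) {a b : ℝ} (hab : a ≤ b) :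
    μ.real {x | a ≤ inner ℝ u x ∧ inner ℝ u x ≤ b} ≤ b - a := by
  have hφ : Measurable (fun x : Euc n => (inner ℝ u x : ℝ)) := by fun_prop
  set φ := (fun x : Euc n => (inner ℝ u x : ℝ)) with hφd
  have hP : IsProbabilityMeasure (μ.map φ) := Measure.isProbabilityMeasure_map hφ.aemeasurable
  have hac : μ ≪ volume := hμ ▸ withDensity_absolutelyContinuous _ _
  have hN : NullSingletonClass (μ.map φ) := by
    constructor
    intro c
    rw [Measure.map_apply hφ (measurableSet_singleton c)]
    apply hac
    have hs : φ ⁻¹' {c} = ((AffineSubspace.mk' (c • u) ((innerSL ℝ u).ker) : AffineSubspace ℝ (Euc n)) : Set (Euc n)) := by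
      ext x
      simp [φ, AffineSubspace.mem_mk', inner_sub_right, inner_smul_right, hu, sub_eq_zero]
    rw [hs]
    apply Measure.addHaar_affineSubspace
    intro ht
    have : c • u + u ∈ (AffineSubspace.mk' (c • u) ((innerSL ℝ u).ker) : AffineSubspace ℝ (Euc n)) := by
      rw [ht]; trivial
    simp [AffineSubspace.mem_mk', hu] at this
  have hre : ∀ S, MeasurableSet S → (μ.map φ).real S = μ.real (φ ⁻¹' S) := fun S hS => by
    rw [measureReal_def, Measure.map_apply hφ hS, measureReal_def]
  have hM := iso_inner_memLp μ hiso u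
  have main := slab_one (μ.map φ) ?_ ?_ ?_ ?_ ?_ ?_ hab
  · rw [hre _ measurableSet_Icc] at main
    exact main
  · rw [integrable_map_measure (by fun_prop) hφ.aemeasurable]
    exact hM.integrable_sq
  · rw [integrable_map_measure (by fun_prop) hφ.aemeasurable]
    exact hM.integrable (by norm_num)
  · rw [integral_map hφ.aemeasurable (by fun_prop)]
    have := integral_inner (𝕜 := ℝ) (iso_int_id μ hiso) u
    rw [hcent, inner_zero_right] at this
    exact this
  · rw [integral_map hφ.aemeasurable (by fun_prop)]
    have := iso_inner_sq μ hiso u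
    rw [hu, one_pow] at this
    exact this
  · intro a b x y ha hb hab
    rw [hre _ measurableSet_Ici, hre _ measurableSet_Ici, hre _ measurableSet_Ici]
    refine lc_measure hgm hg0 hlc μ hμ (hφ measurableSet_Ici) (hφ measurableSet_Ici)
      (hφ measurableSet_Ici) ha hb hab ?_
    intro s hs t ht
    simp only [φ, mem_preimage, mem_Ici, inner_add_right, inner_smul_right] at *
    nlinarith
  · intro a b x y ha hb hab
    rw [hre _ measurableSet_Iic, hre _ measurableSet_Iic, hre _ measurableSet_Iic]
    refine lc_measure hgm hg0 hlc μ hμ (hφ measurableSet_Iic) (hφ measurableSet_Iic)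
      (hφ measurableSet_Iic) ha hb hab ?_
    intro s hs t ht
    simp only [φ, mem_preimage, mem_Iic, inner_add_right, inner_smul_right] at *
    nlinarith


lemma sep_unit {n : ℕ} {C : Set (Euc n)} (hc : Convex ℝ C) (hcl : IsClosed C) (hne : C.Nonempty)
    {z : Euc n} (hz : z ∉ C) :
    ∃ (u : Euc n) (b : ℝ), ‖u‖ = 1 ∧ (∀ a ∈ C, inner ℝ u a ≤ b) ∧ b < inner ℝ u z := by
  obtain ⟨F, c, h1, h2⟩ := geometric_hahn_banach_closed_point hc hcl hz
  obtain ⟨a0, ha0⟩ := hne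
  set w := (InnerProductSpace.toDual ℝ (Euc n)).symm F with hw
  have hF : ∀ x, F x = inner ℝ w x := fun x => by
    rw [hw, InnerProductSpace.toDual_symm_apply]
  have hw0 : w ≠ 0 := by
    intro h
    have h3 := h1 a0 ha0
    rw [hF, h] at h3 h2
    simp at h3 h2
    linarith
  have hwp : 0 < ‖w‖ := norm_pos_iff.2 hw0
  refine ⟨‖w‖⁻¹ • w, ‖w‖⁻¹ * c, ?_, ?_, ?_⟩
  · rw [norm_smul, norm_inv, norm_norm, inv_mul_cancel₀ hwp.ne']
  · intro a ha
    rw [real_inner_smul_left, ← hF]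
    exact mul_le_mul_of_nonneg_left (h1 a ha).le (inv_nonneg.2 hwp.le)
  · rw [real_inner_smul_left, ← hF]
    exact mul_lt_mul_of_pos_left h2 (inv_pos.2 hwp)

lemma half_sq (m : ℝ) (hm : 0 ≤ m) :
    ∫⁻ t in Ioc 0 m, ENNReal.ofReal (m - t) = ENNReal.ofReal (m ^ 2 / 2) := by
  have hi : IntegrableOn (fun t => m - t) (Ioc 0 m) :=
    (Continuous.integrableOn_Icc (by fun_prop)).mono_set Ioc_subset_Icc_self
  rw [← ofReal_integral_eq_lintegral_ofReal hi]
  · rw [← intervalIntegral.integral_of_le hm]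
    congr 1
    rw [intervalIntegral.integral_sub (by simp) (by simp)]
    simp
    ring
  · exact (ae_restrict_iff' measurableSet_Ioc).2 (ae_of_all _ fun t ht => sub_nonneg.2 ht.2)

lemma bary_layer {n : ℕ} (μ : Measure (Euc n)) [IsProbabilityMeasure μ]
    (hx : Integrable (fun x : Euc n => x) μ)
    (u : Euc n)
    (hslab : ∀ a b : ℝ, a ≤ b → μ.real {x | a ≤ inner ℝ u x ∧ inner ℝ u x ≤ b} ≤ b - a)
    {C : Set (Euc n)} (hC : MeasurableSet C) {b : ℝ} (hb : ∀ x ∈ C, inner ℝ u x ≤ b) :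
    μ.real C ^ 2 / 2 ≤ ∫ x in C, (b - inner ℝ u x) ∂μ := by
  set m := μ.real C with hm
  have hm0 : 0 ≤ m := measureReal_nonneg
  have hInt : Integrable (fun x : Euc n => (b - inner ℝ u x : ℝ)) (μ.restrict C) :=
    ((integrable_const b).sub (hx.const_inner u)).restrict
  have hnn : 0 ≤ᵐ[μ.restrict C] fun x : Euc n => (b - inner ℝ u x : ℝ) :=
    (ae_restrict_iff' hC).2 (ae_of_all _ fun x hx => sub_nonneg.2 (hb x hx))
  rw [← ENNReal.ofReal_le_ofReal_iff (integral_nonneg_of_ae hnn),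
    ofReal_integral_eq_lintegral_ofReal hInt hnn,
    lintegral_eq_lintegral_meas_le _ hnn (by fun_prop), ← half_sq m hm0]
  refine le_trans ?_ (lintegral_mono_set (Ioc_subset_Ioi_self : Ioc 0 m ⊆ Ioi 0))
  refine setLIntegral_mono' measurableSet_Ioc fun t ht => ?_
  have hms : MeasurableSet {x : Euc n | t ≤ b - inner ℝ u x} :=
    measurableSet_le measurable_const (by fun_prop)
  rw [Measure.restrict_apply hms, ← ofReal_measureReal]
  apply ENNReal.ofReal_le_ofReal
  have h1 := hslab (b - t) b (by linarith [ht.1])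
  have h2 : C ⊆ ({x : Euc n | t ≤ b - inner ℝ u x} ∩ C) ∪
      {x | b - t ≤ inner ℝ u x ∧ inner ℝ u x ≤ b} := by
    intro x hxC
    by_cases h : t ≤ b - inner ℝ u x
    · exact Or.inl ⟨h, hxC⟩
    · exact Or.inr ⟨by push Not at h; linarith, hb x hxC⟩
  have h3 := (measureReal_mono (μ := μ) h2).trans (measureReal_union_le _ _)
  linarith

lemma bary_zero {n : ℕ} (μ : Measure (Euc n)) [IsProbabilityMeasure μ]
    (hx : Integrable (fun x : Euc n => x) μ)
    {C : Set (Euc n)} (hm : 0 < μ.real C) (L : Euc n →L[ℝ] ℝ) :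
    ∫ x in C, L (x - (μ.real C)⁻¹ • ∫ y in C, y ∂μ) ∂μ = 0 := by
  have h1 : Integrable (fun x => L x) (μ.restrict C) := L.integrable_comp hx.restrict
  simp_rw [map_sub]
  rw [integral_sub h1 (integrable_const _), L.integral_comp_comm hx.restrict]
  simp
  field_simp
  simp

lemma bary_ball {n : ℕ} (μ : Measure (Euc n)) [IsProbabilityMeasure μ]
    (hx : Integrable (fun x : Euc n => x) μ)
    (hslab : ∀ u : Euc n, ‖u‖ = 1 → ∀ a b : ℝ, a ≤ b →
      μ.real {x | a ≤ inner ℝ u x ∧ inner ℝ u x ≤ b} ≤ b - a)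
    {C : Set (Euc n)} (hC : IsCompact C) (hcv : Convex ℝ C) (hm : 0 < μ.real C) :
    closedBall ((μ.real C)⁻¹ • ∫ y in C, y ∂μ) (μ.real C / 2) ⊆ C := by
  intro z hz
  by_contra hzC
  have hne : C.Nonempty := by
    rw [nonempty_iff_ne_empty]
    rintro rfl
    simp at hm
  obtain ⟨u, b, hu, h1, h2⟩ := sep_unit hcv hC.isClosed hne hzC
  have h3 := bary_layer μ hx u (hslab u hu) hC.measurableSet h1
  have h4 := bary_zero μ hx hm (innerSL ℝ u)
  set x0 := (μ.real C)⁻¹ • ∫ y in C, y ∂μ with hx0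
  have hInt : Integrable (fun x : Euc n => (innerSL ℝ u (x - x0) : ℝ)) (μ.restrict C) :=
    ContinuousLinearMap.integrable_comp _ (hx.restrict.sub (integrable_const _))
  have h5 : ∫ x in C, (b - inner ℝ u x) ∂μ = μ.real C * (b - inner ℝ u x0) := by
    have : ∀ x : Euc n, (b - inner ℝ u x : ℝ) = (b - inner ℝ u x0) - innerSL ℝ u (x - x0) := by
      intro x
      simp [inner_sub_right]
    rw [integral_congr_ae (ae_of_all _ this)]
    rw [integral_sub (integrable_const _) hInt, h4]
    simp
  rw [h5] at h3
  have h6 : μ.real C / 2 ≤ b - inner ℝ u x0 := by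
    by_contra hcon
    push Not at hcon
    nlinarith
  have h7 : (inner ℝ u z : ℝ) - inner ℝ u x0 ≤ μ.real C / 2 := by
    rw [← inner_sub_right]
    refine (real_inner_le_norm _ _).trans ?_
    rw [hu, one_mul, ← dist_eq_norm]
    exact hz
  linarith

lemma bary_mem {n : ℕ} (μ : Measure (Euc n)) [IsProbabilityMeasure μ]
    (hx : Integrable (fun x : Euc n => x) μ)
    {U : Set (Euc n)} (hU : IsOpen U) (hUc : Convex ℝ U) (hμU : ∀ᵐ x ∂μ, x ∈ U)
    {C : Set (Euc n)} (hm : 0 < μ.real C) :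
    (μ.real C)⁻¹ • ∫ y in C, y ∂μ ∈ U := by
  by_contra h
  obtain ⟨F, hF⟩ := geometric_hahn_banach_open_point hUc hU h
  have h4 := bary_zero μ hx hm (-F)
  set x0 := (μ.real C)⁻¹ • ∫ y in C, y ∂μ with hx0
  have hInt : Integrable (fun x : Euc n => ((-F) (x - x0) : ℝ)) (μ.restrict C) :=
    ContinuousLinearMap.integrable_comp _ (hx.restrict.sub (integrable_const _))
  have hae : ∀ᵐ x ∂(μ.restrict C), 0 < (-F) (x - x0) := by
    filter_upwards [ae_restrict_of_ae hμU] with x hxU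
    have := hF x hxU
    simp only [neg_apply, map_sub]
    linarith
  have hz := (integral_eq_zero_iff_of_nonneg_ae (hae.mono fun x h => h.le) hInt).1 h4
  have hfalse : ∀ᵐ x ∂(μ.restrict C), False := by
    filter_upwards [hae, hz] with x h1 h2
    rw [h2] at h1
    simp at h1
  have : μ.restrict C = 0 := by
    simpa using hfalse
  rw [Measure.restrict_eq_zero] at this
  simp [measureReal_def, this] at hm

lemma supergrad {n : ℕ} {U : Set (Euc n)} (hU : IsOpen U) {φ : Euc n → ℝ}
    (hφ : ConcaveOn ℝ U φ) {x0 : Euc n} (hx0 : x0 ∈ U) :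
    ∃ L : Euc n →L[ℝ] ℝ, ∀ x ∈ U, φ x ≤ φ x0 + L (x - x0) := by
  have hc : ContinuousOn φ U := hφ.continuousOn hU
  have hcv : Convex ℝ {p : Euc n × ℝ | p.1 ∈ U ∧ p.2 < φ p.1} := hφ.convex_strict_hypograph
  have hop : IsOpen {p : Euc n × ℝ | p.1 ∈ U ∧ p.2 < φ p.1} := by
    rw [isOpen_iff_mem_nhds]
    rintro ⟨x, t⟩ ⟨hx, ht⟩
    have h1 : ContinuousAt φ x := hc.continuousAt (hU.mem_nhds hx)
    have h2 : ContinuousAt (fun p : Euc n × ℝ => φ p.1) (x, t) :=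
      ContinuousAt.comp (f := Prod.fst) (x := (x, t)) h1 continuousAt_fst
    have h3 : ∀ᶠ p : Euc n × ℝ in nhds (x, t), p.2 < φ p.1 :=
      continuousAt_snd.eventually_lt h2 ht
    have h4 : ∀ᶠ p : Euc n × ℝ in nhds (x, t), p.1 ∈ U :=
      continuousAt_fst.eventually (hU.mem_nhds hx)
    filter_upwards [h3, h4] with p hp1 hp2
    exact ⟨hp2, hp1⟩
  have hnot : (x0, φ x0) ∉ {p : Euc n × ℝ | p.1 ∈ U ∧ p.2 < φ p.1} := fun h => lt_irrefl _ h.2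
  obtain ⟨F, hF⟩ := geometric_hahn_banach_point_open hcv hop hnot
  set c := F (0, 1) with hc'
  set G : Euc n →L[ℝ] ℝ := F.comp (ContinuousLinearMap.inl ℝ (Euc n) ℝ) with hG
  have hdec : ∀ x t, F (x, t) = G x + t * c := by
    intro x t
    have : (x, t) = (x, (0:ℝ)) + t • ((0 : Euc n), (1:ℝ)) := by simp
    rw [this, map_add, map_smul]
    simp [hG, hc']
  have hcneg : c < 0 := by
    have := hF (x0, φ x0 - 1) ⟨hx0, by simp⟩
    rw [hdec, hdec] at this
    linarith
  refine ⟨(-c)⁻¹ • G, fun x hx => ?_⟩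
  have h1 : ∀ s < φ x, G x0 + φ x0 * c < G x + s * c := by
    intro s hs
    have := hF (x, s) ⟨hx, hs⟩
    rwa [hdec, hdec] at this
  have h2 : G x0 + φ x0 * c ≤ G x + φ x * c := by
    by_contra hcon
    push Not at hcon
    have := h1 (φ x - (G x0 + φ x0 * c - (G x + φ x * c)) / (-c))
      (by have : 0 < (G x0 + φ x0 * c - (G x + φ x * c)) / (-c) := div_pos (by linarith) (by linarith)
          linarith)
    have h3 : (G x0 + φ x0 * c - (G x + φ x * c)) / (-c) * c =
      -(G x0 + φ x0 * c - (G x + φ x * c)) := by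
      rw [div_neg, neg_mul, div_mul_cancel₀ _ hcneg.ne]
    rw [sub_mul, h3] at this
    linarith
  have h3 : φ x - φ x0 ≤ (-c)⁻¹ * (G x - G x0) := by
    rw [inv_mul_eq_div, le_div_iff₀ (by linarith)]
    linarith
  simp only [ContinuousLinearMap.smul_apply, map_sub, smul_eq_mul]
  linarith


lemma shrink_mem {n : ℕ} {A : Set (Euc n)} (hAc : Convex ℝ A) (hAk : IsCompact A)
    (hne : A.Nonempty) {ε h l : ℝ} (hε : 0 < ε) (hl0 : 0 ≤ l) (hl1 : l ≤ 1) (hlh : l * h = ε)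
    (hh : 0 ≤ h) {x0 : Euc n} (hb : closedBall x0 h ⊆ A + closedBall 0 ε)
    {c : Euc n} (hc : c ∈ A + closedBall (0 : Euc n) ε) : (1 - l) • c + l • x0 ∈ A := by
  by_contra hz
  obtain ⟨u, b, hu, h1, h2⟩ := sep_unit hAc hAk.isClosed hne hz
  have hcv : Convex ℝ (A + closedBall (0 : Euc n) ε) := hAc.add (convex_closedBall 0 ε)
  have hx : x0 + h • u ∈ A + closedBall (0 : Euc n) ε := by
    apply hb
    simp [norm_smul, hu, abs_of_nonneg hh]
  have hmem := hcv hc hx (sub_nonneg.2 hl1) hl0 (by ring)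
  obtain ⟨a, ha, e, he, hae⟩ := hmem
  have h3 : (inner ℝ u (a + e) : ℝ) = inner ℝ u ((1 - l) • c + l • x0) + ε := by
    have : a + e = ((1 - l) • c + l • x0) + (l * h) • u := by
      simp only at hae
      rw [hae, smul_add, smul_smul, add_assoc]
    rw [this, hlh, inner_add_right, inner_smul_right, real_inner_self_eq_norm_sq, hu]
    ring
  have h4 : (inner ℝ u e : ℝ) ≤ ε := by
    refine (real_inner_le_norm _ _).trans ?_
    rw [hu, one_mul]
    simpa using he
  rw [inner_add_right] at h3
  have := h1 a ha
  linarith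

lemma pointwise_lower {n : ℕ} {g : Euc n → ℝ} {U : Set (Euc n)}
    (hpos : ∀ x ∈ U, 0 < g x)
    (hlc : ∀ x y : Euc n, ∀ a b : ℝ, 0 < a → 0 < b → a + b = 1 → g x ^ a * g y ^ b ≤ g (a • x + b • y))
    {x0 : Euc n} (hx0 : x0 ∈ U) {L : Euc n →L[ℝ] ℝ}
    (hL : ∀ x ∈ U, Real.log (g x) ≤ Real.log (g x0) + L (x - x0))
    {l : ℝ} (hl0 : 0 < l) (hl1 : l < 1) {x : Euc n} (hx : x ∈ U) :
    g x * (1 - l * L (x - x0)) ≤ g ((1 - l) • x + l • x0) := by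
  refine le_trans ?_ (hlc x x0 (1 - l) l (by linarith) hl0 (by ring))
  have hgx := hpos x hx
  have hg0 := hpos x0 hx0
  have e : g x ^ (1 - l) * g x0 ^ l = g x * Real.exp (l * (Real.log (g x0) - Real.log (g x))) := by
    rw [Real.rpow_def_of_pos hgx, Real.rpow_def_of_pos hg0, ← Real.exp_add]
    nth_rewrite 2 [← Real.exp_log hgx]
    rw [← Real.exp_add]
    congr 1
    ring
  rw [e]
  apply mul_le_mul_of_nonneg_left _ hgx.le
  have h1 := Real.add_one_le_exp (l * (Real.log (g x0) - Real.log (g x)))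
  have h2 := hL x hx
  nlinarith

lemma ofReal_int_le {α : Type*} [MeasurableSpace α] {ν : Measure α} {h : α → ℝ}
    (hi : Integrable h ν) : ENNReal.ofReal (∫ x, h x ∂ν) ≤ ∫⁻ x, ENNReal.ofReal (h x) ∂ν := by
  have h1 : ∫ x, h x ∂ν ≤ ∫ x, max (h x) 0 ∂ν :=
    integral_mono hi hi.pos_part fun x => le_max_left _ _
  refine (ENNReal.ofReal_le_ofReal h1).trans ?_
  rw [ofReal_integral_eq_lintegral_ofReal hi.pos_part (ae_of_all _ fun x => le_max_right _ _)]
  refine lintegral_mono fun x => ?_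
  simp

lemma main_lower {n : ℕ} {g : Euc n → ℝ} {U : Set (Euc n)} (hU : IsOpen U) (hUc : Convex ℝ U)
    (hgm : Measurable g) (hg0 : ∀ x, 0 ≤ g x)
    (hpos : ∀ x ∈ U, 0 < g x) (hz : ∀ x, x ∉ U → g x = 0)
    (hlog : ConcaveOn ℝ U (fun x => Real.log (g x)))
    (hlc : ∀ x y : Euc n, ∀ a b : ℝ, 0 < a → 0 < b → a + b = 1 → g x ^ a * g y ^ b ≤ g (a • x + b • y))
    (μ : Measure (Euc n)) [IsProbabilityMeasure μ]
    (hμ : μ = volume.withDensity (fun x => ENNReal.ofReal (g x)))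
    (hx : Integrable (fun x : Euc n => x) μ)
    (hslab : ∀ u : Euc n, ‖u‖ = 1 → ∀ a b : ℝ, a ≤ b →
      μ.real {x | a ≤ inner ℝ u x ∧ inner ℝ u x ≤ b} ≤ b - a)
    {A : Set (Euc n)} (hAc : Convex ℝ A) (hAk : IsCompact A) (hne : A.Nonempty)
    {ε : ℝ} (hε : 0 < ε) (hm : 2 * ε < μ.real (A + closedBall (0 : Euc n) ε)) :
    (1 - ε / (μ.real (A + closedBall (0 : Euc n) ε) / 2)) ^ n *
      μ.real (A + closedBall (0 : Euc n) ε) ≤ μ.real A := by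
  set C := A + closedBall (0 : Euc n) ε with hC
  set m := μ.real C with hmd
  set l := ε / (m / 2) with hl
  have hm0 : 0 < m := by linarith
  have hl0 : 0 < l := by positivity
  have hl1 : l < 1 := by rw [hl, div_lt_one (by positivity)]; linarith
  have hCk : IsCompact C := hAk.add (isCompact_closedBall 0 ε)
  have hCc : Convex ℝ C := hAc.add (convex_closedBall 0 ε)
  have hball := bary_ball μ hx hslab hCk hCc hm0
  have hm_ac : Measurable (fun x => ENNReal.ofReal (g x)) := hgm.ennreal_ofReal
  have hμU : ∀ᵐ x ∂μ, x ∈ U := by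
    rw [hμ, ae_withDensity_iff hm_ac]
    refine ae_of_all _ fun x h => ?_
    by_contra hxU
    rw [hz x hxU] at h
    simp at h
  have hx0U := bary_mem μ hx hU hUc hμU hm0
  have hzero := fun L => bary_zero μ hx hm0 L
  rw [← hmd] at hball hx0U hzero
  set x0 := m⁻¹ • ∫ y in C, y ∂μ with hx0
  obtain ⟨L, hL⟩ := supergrad hU hlog hx0U
  set T : Euc n → Euc n := fun x => (1 - l) • x + l • x0 with hT
  have hTA : T '' C ⊆ A := by
    rintro _ ⟨c, hc, rfl⟩
    exact shrink_mem hAc hAk hne hε hl0.le hl1.le (by rw [hl]; field_simp) (by positivity) hball hc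
  have hTc : Continuous T := by fun_prop
  have hd : ∀ x ∈ C, HasFDerivWithinAt T ((1 - l) • ContinuousLinearMap.id ℝ (Euc n)) C x := by
    intro x _
    exact (((hasFDerivAt_id x).const_smul (1 - l)).add_const (l • x0)).hasFDerivWithinAt
  have hinj : InjOn T C := by
    intro x _ y _ hxy
    have h1 : (1 - l) • x = (1 - l) • y := add_right_cancel hxy
    exact smul_right_injective _ (by linarith : (1 - l) ≠ 0) h1
  have hdet : |((1 - l) • ContinuousLinearMap.id ℝ (Euc n)).det| = (1 - l) ^ n := by
    have : ((1 - l) • ContinuousLinearMap.id ℝ (Euc n)).det = (1 - l) ^ n := by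
      rw [ContinuousLinearMap.det]
      have : (((1 - l) • ContinuousLinearMap.id ℝ (Euc n) : Euc n →L[ℝ] Euc n) : Euc n →ₗ[ℝ] Euc n) =
        (1 - l) • LinearMap.id := rfl
      rw [this, LinearMap.det_smul]
      simp
    rw [this, abs_of_nonneg (pow_nonneg (by linarith) n)]
  have hmeasC := hCk.measurableSet
  have h1 : μ (T '' C) = ∫⁻ x in C, ENNReal.ofReal ((1 - l) ^ n) * ENNReal.ofReal (g (T x)) := by
    rw [hμ, withDensity_apply _ (hCk.image hTc).measurableSet,
      lintegral_image_eq_lintegral_abs_det_fderiv_mul volume hmeasC hd hinj, hdet]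
  have hInt0 : Integrable (fun x => L (x - x0)) (μ.restrict C) :=
    L.integrable_comp (hx.restrict.sub (integrable_const _))
  have hInt : Integrable (fun x => 1 - l * L (x - x0)) (μ.restrict C) :=
    (integrable_const _).sub (hInt0.const_mul l)
  have h2 : ∫ x in C, (1 - l * L (x - x0)) ∂μ = m := by
    rw [integral_sub (integrable_const _) (hInt0.const_mul l), integral_const_mul, hzero L]
    simp [hmd]
  have h3 : ENNReal.ofReal m ≤ ∫⁻ x in C, ENNReal.ofReal (g (T x)) := by
    rw [← h2]
    refine (ofReal_int_le hInt).trans ?_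
    have hmm : Measurable fun x => ENNReal.ofReal (1 - l * L (x - x0)) := by fun_prop
    rw [hμ, setLIntegral_withDensity_eq_setLIntegral_mul _ hm_ac hmm hmeasC]
    refine lintegral_mono fun x => ?_
    simp only [Pi.mul_apply]
    rw [← ENNReal.ofReal_mul (hg0 x)]
    apply ENNReal.ofReal_le_ofReal
    by_cases hxU : x ∈ U
    · exact pointwise_lower hpos hlc hx0U hL hl0 hl1 hxU
    · rw [hz x hxU, zero_mul]; exact hg0 _
  have h4 : ENNReal.ofReal ((1 - l) ^ n * m) ≤ μ A := by
    refine le_trans ?_ (measure_mono hTA)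
    rw [h1, lintegral_const_mul' _ _ ENNReal.ofReal_ne_top,
      ENNReal.ofReal_mul (pow_nonneg (by linarith) n)]
    gcongr
  exact (ENNReal.ofReal_le_iff_le_toReal (measure_ne_top μ A)).1 h4

lemma main_diff {n : ℕ} {g : Euc n → ℝ} {U : Set (Euc n)} (hU : IsOpen U) (hUc : Convex ℝ U)
    (hgm : Measurable g) (hg0 : ∀ x, 0 ≤ g x)
    (hpos : ∀ x ∈ U, 0 < g x) (hz : ∀ x, x ∉ U → g x = 0)
    (hlog : ConcaveOn ℝ U (fun x => Real.log (g x)))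
    (hlc : ∀ x y : Euc n, ∀ a b : ℝ, 0 < a → 0 < b → a + b = 1 → g x ^ a * g y ^ b ≤ g (a • x + b • y))
    (μ : Measure (Euc n)) [IsProbabilityMeasure μ]
    (hμ : μ = volume.withDensity (fun x => ENNReal.ofReal (g x)))
    (hx : Integrable (fun x : Euc n => x) μ)
    (hslab : ∀ u : Euc n, ‖u‖ = 1 → ∀ a b : ℝ, a ≤ b →
      μ.real {x | a ≤ inner ℝ u x ∧ inner ℝ u x ≤ b} ≤ b - a)
    {A : Set (Euc n)} (hAc : Convex ℝ A) (hAk : IsCompact A) (hne : A.Nonempty) (hn : 1 ≤ n)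
    {ε : ℝ} (hε : 0 < ε) :
    μ.real ((A + closedBall (0 : Euc n) ε) \ A) ≤ 2 * n * ε := by
  have hn' : (1 : ℝ) ≤ n := by exact_mod_cast hn
  have hsub : A ⊆ A + closedBall (0 : Euc n) ε := by
    intro a ha
    exact ⟨a, ha, 0, by simp [hε.le], by simp⟩
  rcases le_or_gt (μ.real (A + closedBall (0 : Euc n) ε)) (2 * ε) with h | h
  · refine (measureReal_mono diff_subset).trans (h.trans ?_)
    nlinarith
  · have h1 := main_lower hU hUc hgm hg0 hpos hz hlog hlc μ hμ hx hslab hAc hAk hne hε h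
    rw [measureReal_diff hsub hAk.measurableSet]
    set m := μ.real (A + closedBall (0 : Euc n) ε)
    have hm0 : 0 < m := by linarith
    have hl1 : ε / (m / 2) ≤ 1 := by rw [div_le_one (by positivity)]; linarith
    have h2 := one_add_mul_le_pow (a := -(ε / (m / 2))) (by linarith) n
    rw [← sub_eq_add_neg] at h2
    have h3 : (1 + (n : ℝ) * -(ε / (m / 2))) * m = m - 2 * n * ε := by
      field_simp
      ring
    have h4 := mul_le_mul_of_nonneg_right h2 hm0.le
    linarith

theorem perimeter_general_estimate {n : ℕ} (f : Euc n → ℝ) (μ : Measure (Euc n))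
    [IsProbabilityMeasure μ]
    (hf : IsLogConcaveFn f)
    (hμ : μ = volume.withDensity (fun x => ENNReal.ofReal (f x)))
    (hcent : ∫ x, x ∂μ = 0)
    (hiso : ∀ i j : Fin n, ∫ x, x i * x j ∂μ = if i = j then 1 else 0)
    (A : Set (Euc n)) (hA : IsConvexBody A)
    (xA : Euc n) (rA : ℝ)
    (hrA : rA = inradius A)
    (hball : closedBall xA rA ⊆ A) :
    muPerim μ A ≤ 2 * Real.sqrt n * ((n : ℝ) + Real.log (sSup (f '' A) / f xA)) := by
  have hne : A.Nonempty := hA.2.2.mono interior_subset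
  rcases Nat.eq_zero_or_pos n with hn | hn
  · subst hn
    have hAu : A = univ := Subsingleton.eq_univ_of_nonempty hne
    have : muPerim μ A = 0 := by
      unfold muPerim
      rw [hAu]
      simp
    rw [this]
    simp
  · obtain ⟨g, U, hU, hUc, hpos, hz, hlog, hgm, hfg⟩ := nice_density f hf
    have hg0 : ∀ x, 0 ≤ g x := fun z => by
      by_cases h : z ∈ U
      · exact (hpos z h).le
      · exact (hz z h).ge
    have hlc : ∀ x y : Euc n, ∀ a b : ℝ, 0 < a → 0 < b → a + b = 1 →
        g x ^ a * g y ^ b ≤ g (a • x + b • y) := fun x y a b ha hb hab =>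
      nice_lc hUc hpos hz hlog x y ha hb hab
    have hμg : μ = volume.withDensity (fun x => ENNReal.ofReal (g x)) := by
      rw [hμ]
      refine withDensity_congr_ae ?_
      filter_upwards [hfg] with x hx
      rw [hx]
    have hslab : ∀ u : Euc n, ‖u‖ = 1 → ∀ a b : ℝ, a ≤ b →
        μ.real {x | a ≤ inner ℝ u x ∧ inner ℝ u x ≤ b} ≤ b - a := fun u hu a b hab =>
      slab hgm hg0 hlc μ hμg hcent hiso u hu hab
    have hn' : (1 : ℝ) ≤ n := by exact_mod_cast hn
    have hper : muPerim μ A ≤ 2 * n := by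
      unfold muPerim
      have hb : ∀ᶠ ε in nhdsWithin (0 : ℝ) (Ioi 0),
          (μ ((A + closedBall (0 : Euc n) ε) \ A)).toReal / ε ≤ 2 * n := by
        filter_upwards [self_mem_nhdsWithin] with ε hε
        have hε' : 0 < ε := hε
        rw [div_le_iff₀ hε']
        exact main_diff hU hUc hgm hg0 hpos hz hlog hlc μ hμg (iso_int_id μ hiso) hslab hA.1 hA.2.1
          hne hn hε'
      have hb0 : ∀ᶠ ε in nhdsWithin (0 : ℝ) (Ioi 0),
          0 ≤ (μ ((A + closedBall (0 : Euc n) ε) \ A)).toReal / ε := by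
        filter_upwards [self_mem_nhdsWithin] with ε hε
        have hε' : 0 < ε := hε
        positivity
      exact liminf_le_of_le ⟨0, by simpa using hb0⟩ fun b hbb => by
        obtain ⟨ε, h1, h2⟩ := (hbb.and hb).exists
        exact h1.trans h2
    have hrA0 : 0 ≤ rA := by
      rw [hrA]
      exact Real.sSup_nonneg fun r hr => hr.1.le
    have hxA : xA ∈ A := hball (mem_closedBall_self hrA0)
    have hlog0 : 0 ≤ Real.log (sSup (f '' A) / f xA) := by
      by_cases hbd : BddAbove (f '' A)
      · rcases (hf.1 xA).eq_or_lt with h0 | h0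
        · rw [← h0]; simp
        · apply Real.log_nonneg
          rw [le_div_iff₀ h0, one_mul]
          exact le_csSup hbd ⟨xA, hxA, rfl⟩
      · rw [Real.sSup_of_not_bddAbove hbd]; simp
    have hs : (1 : ℝ) ≤ Real.sqrt n := Real.one_le_sqrt.2 hn'
    refine hper.trans ?_
    nlinarith [mul_nonneg (by linarith : (0 : ℝ) ≤ Real.sqrt n - 1) (by linarith : (0 : ℝ) ≤ n),
      mul_nonneg (by linarith : (0 : ℝ) ≤ Real.sqrt n) hlog0]
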